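/- arXiv:2002.11234 — 2 statements merged into one kernel-verified Lean document; each statement's English description precedes it below -/
import Mathlib

section
/- With self-loop weight ℓ = d/N and interpolation parameter s = 1 − 1/N, the cotangent quantum hitting times of the lackadaisical quantum walk and of Szegedy's quantum interpolated walk satisfy the exact identity QHT(U_lazy, |init_lazy⟩)² = ((N+1)/N)·QHT(W(s), |init_ip⟩)² + 1/(2N−1). -/
open scoped BigOperators ComplexConjugate
open Complex

set_option linter.unusedSectionVars false

noncomputable section

namespace LQWPaper

variable {V : Type*} [Fintype V] [DecidableEq V]

/-- The inner product `⟨v,w⟩ = Σᵢ conj (v i) * w i` on `ι → ℂ`. -/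
def cip {ι : Type*} [Fintype ι] (v w : ι → ℂ) : ℂ :=
  ∑ i, (starRingEnd ℂ) (v i) * w i

/-- The `ℓ₂`-norm on `ι → ℂ`. -/
def l2norm {ι : Type*} [Fintype ι] (v : ι → ℂ) : ℝ :=
  Real.sqrt (∑ i, Complex.normSq (v i))

/-- The operator norm (with respect to the `ℓ₂`-norm) of a square matrix. -/
def opNorm {ι : Type*} [Fintype ι] (M : Matrix ι ι ℂ) : ℝ :=
  sSup {r : ℝ | ∃ v : ι → ℂ, l2norm v = 1 ∧ r = l2norm (M.mulVec v)}

/-- A fixed labeling `y_1(x), …, y_d(x)` of the `d` neighbors of each vertex of a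
`d`-regular graph: a bijection from `Fin d` to the neighbor set of each vertex. -/
structure Labeling (G : SimpleGraph V) (d : ℕ) where
  nbr : (x : V) → Fin d ≃ (G.neighborSet x)

lemma Labeling.adj {G : SimpleGraph V} {d : ℕ} (L : Labeling G d) (x : V) (i : Fin d) :
    G.Adj x (L.nbr x i) := (L.nbr x i).prop

/-- The (unique) index of `x` among the neighbors of `y`. -/
def Labeling.idx {G : SimpleGraph V} {d : ℕ} (L : Labeling G d) (y x : V)
    (h : G.Adj y x) : Fin d := (L.nbr y).symm ⟨x, h⟩

/-- The flip-flop shift on basis states: `|x, e_i⟩ ↦ |y, e_j⟩` where `y = y_i(x)` and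
`x = y_j(y)`, and `|x, ↻⟩ ↦ |x, ↻⟩`.  The self-loop is the coin index `Fin.last d`. -/
def shiftFun {G : SimpleGraph V} {d : ℕ} (L : Labeling G d)
    (p : V × Fin (d + 1)) : V × Fin (d + 1) :=
  if h : p.2 = Fin.last d then p
  else
    let i : Fin d := p.2.castPred h
    ⟨L.nbr p.1 i, Fin.castSucc (L.idx (L.nbr p.1 i) p.1 ((L.adj p.1 i).symm))⟩

/-- The flip-flop shift operator `S` as a matrix. -/
def shiftMat {G : SimpleGraph V} {d : ℕ} (L : Labeling G d) :
    Matrix (V × Fin (d + 1)) (V × Fin (d + 1)) ℂ :=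
  Matrix.of fun p q => if p = shiftFun L q then 1 else 0

/-- The coin state `|c⟩ = (1/√(d+ℓ)) (|e_1⟩ + ⋯ + |e_d⟩ + √ℓ |↻⟩)`. -/
def coinVec (d : ℕ) (ℓ : ℝ) : Fin (d + 1) → ℂ :=
  fun a => if a = Fin.last d then ((Real.sqrt ℓ / Real.sqrt (d + ℓ) : ℝ) : ℂ)
           else ((1 / Real.sqrt (d + ℓ) : ℝ) : ℂ)

/-- The coin operator `C = 2|c⟩⟨c| − I`. -/
def coinMat (d : ℕ) (ℓ : ℝ) : Matrix (Fin (d + 1)) (Fin (d + 1)) ℂ :=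
  (2 : ℂ) • Matrix.of (fun a b => coinVec d ℓ a * (starRingEnd ℂ) (coinVec d ℓ b)) - 1

/-- The global coin operator `I_N ⊗ C`. -/
def coinLift (d : ℕ) (ℓ : ℝ) :
    Matrix (V × Fin (d + 1)) (V × Fin (d + 1)) ℂ :=
  Matrix.of fun p q => if p.1 = q.1 then coinMat d ℓ p.2 q.2 else 0

/-- The oracle `G_or = (I_N − 2|m⟩⟨m|) ⊗ I_{d+1}`. -/
def oracleMat (d : ℕ) (m : V) : Matrix (V × Fin (d + 1)) (V × Fin (d + 1)) ℂ :=
  Matrix.of fun p q => if p = q then (if p.1 = m then -1 else 1) else 0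

/-- The lackadaisical quantum walk `U_lazy = S · (I_N ⊗ C) · G_or`. -/
def Ulazy {G : SimpleGraph V} {d : ℕ} (L : Labeling G d) (m : V) (ℓ : ℝ) :
    Matrix (V × Fin (d + 1)) (V × Fin (d + 1)) ℂ :=
  shiftMat L * coinLift d ℓ * oracleMat d m

/-- The initial state `|init_lazy⟩ = (1/√(N−1)) Σ_{x ≠ m} |x⟩ ⊗ |c⟩`. -/
def initLazy (m : V) (d : ℕ) (ℓ : ℝ) : V × Fin (d + 1) → ℂ :=
  fun p => if p.1 = m then 0
    else ((1 / Real.sqrt ((Fintype.card V : ℝ) - 1) : ℝ) : ℂ) * coinVec d ℓ p.2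

/-- The state `|⇒⟩ = (1/√d)(|e_1⟩ + ⋯ + |e_d⟩)`. -/
def plusVec (d : ℕ) : Fin (d + 1) → ℂ :=
  fun a => if a = Fin.last d then 0 else ((1 / Real.sqrt d : ℝ) : ℂ)

/-- The modified oracle `Ĝ_or = I − 2(|m,↻⟩⟨m,↻| + |m,⇒⟩⟨m,⇒|)`. -/
def oracleHat (d : ℕ) (m : V) : Matrix (V × Fin (d + 1)) (V × Fin (d + 1)) ℂ :=
  1 - (2 : ℂ) • Matrix.of (fun p q =>
    (if p = (m, Fin.last d) ∧ q = (m, Fin.last d) then 1 else 0)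
    + (if p.1 = m ∧ q.1 = m then plusVec d p.2 * (starRingEnd ℂ) (plusVec d q.2) else 0))

/-- The modified lackadaisical quantum walk `Û_lazy = S · (I_N ⊗ C) · Ĝ_or`. -/
def UlazyHat {G : SimpleGraph V} {d : ℕ} (L : Labeling G d) (m : V) (ℓ : ℝ) :
    Matrix (V × Fin (d + 1)) (V × Fin (d + 1)) ℂ :=
  shiftMat L * coinLift d ℓ * oracleHat d m

/-- The action of an automorphism `σ` of `G` on arcs and self-loops:
`P_σ |x, e_i⟩ = |σ x, e_j⟩` with `y_j(σ x) = σ (y_i x)`, and `P_σ |x, ↻⟩ = |σ x, ↻⟩`. -/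
def permFun {G : SimpleGraph V} {d : ℕ} (L : Labeling G d) (σ : G ≃g G)
    (p : V × Fin (d + 1)) : V × Fin (d + 1) :=
  if h : p.2 = Fin.last d then (σ p.1, p.2)
  else
    let i : Fin d := p.2.castPred h
    ⟨σ p.1, Fin.castSucc (L.idx (σ p.1) (σ (L.nbr p.1 i)) (σ.map_adj_iff.mpr (L.adj p.1 i)))⟩

/-- The unitary `P_σ` induced by an automorphism `σ` of `G`, as a matrix. -/
def permMat {G : SimpleGraph V} {d : ℕ} (L : Labeling G d) (σ : G ≃g G) :
    Matrix (V × Fin (d + 1)) (V × Fin (d + 1)) ℂ :=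
  Matrix.of fun p q => if p = permFun L σ q then 1 else 0

/-- `G` is locally arc-transitive if for any vertex `u` with neighbors `v₁, v₂` there is an
automorphism of `G` fixing `u` and mapping `v₁` to `v₂`. -/
def LocallyArcTransitive (G : SimpleGraph V) : Prop :=
  ∀ u v₁ v₂ : V, G.Adj u v₁ → G.Adj u v₂ → ∃ σ : G ≃g G, σ u = u ∧ σ v₁ = v₂

/-- The transition matrix `P` of the simple random walk on a `d`-regular graph. -/
def Pmat (G : SimpleGraph V) [DecidableRel G.Adj] (d : ℕ) : Matrix V V ℝ :=
  Matrix.of fun x y => if G.Adj x y then (1 : ℝ) / d else 0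

/-- The absorbing walk: row `m` is replaced by the unit vector at `m`. -/
def absorb (M : Matrix V V ℝ) (m : V) : Matrix V V ℝ :=
  Matrix.of fun x y => if x = m then (if y = m then 1 else 0) else M x y

/-- The interpolated walk `M(s) = (1−s) M + s M'`. -/
def interp (M : Matrix V V ℝ) (m : V) (s : ℝ) : Matrix V V ℝ :=
  (1 - s) • M + s • absorb M m

/-- The lazy random walk `P̂ = (d/(d+ℓ)) P + (ℓ/(d+ℓ)) I`. -/
def lazyP (G : SimpleGraph V) [DecidableRel G.Adj] (d : ℕ) (ℓ : ℝ) : Matrix V V ℝ :=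
  ((d : ℝ) / (d + ℓ)) • Pmat G d + (ℓ / (d + ℓ)) • (1 : Matrix V V ℝ)

/-- The submatrix `Q` of `P` obtained by deleting the row and column of `m`. -/
def Qsub (P : Matrix V V ℝ) (m : V) :
    Matrix {x : V // x ≠ m} {x : V // x ≠ m} ℝ :=
  Matrix.of fun x y => P x.1 y.1

/-- The hitting time `HT(P, {m}) = Σ_{t≥0} (1/N) Σ_{x≠m, y≠m} (Q^t)_{xy}`. -/
def hittingTime (P : Matrix V V ℝ) (m : V) : ℝ :=
  ∑' t : ℕ, (1 / (Fintype.card V : ℝ)) *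
    ∑ x : {x : V // x ≠ m}, ∑ y : {x : V // x ≠ m}, (Qsub P m ^ t) x y

/-- The state `|x⟩ ⊗ |P(s)_x⟩ = Σ_y √(P(s)_{xy}) |x,y⟩`. -/
def psVec (Ps : Matrix V V ℝ) (x : V) : V × V → ℂ :=
  fun p => if p.1 = x then ((Real.sqrt (Ps x p.2) : ℝ) : ℂ) else 0

/-- The projection `Π_A = Σ_x |x, P(s)_x⟩⟨x, P(s)_x|` onto `span{|x⟩ ⊗ |P(s)_x⟩}`. -/
def projA (Ps : Matrix V V ℝ) : Matrix (V × V) (V × V) ℂ :=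
  Matrix.of fun p q => ∑ x, psVec Ps x p * (starRingEnd ℂ) (psVec Ps x q)

/-- The swap of the two tensor factors of `ℂ^V ⊗ ℂ^V`, as a matrix. -/
def swapMat (V : Type*) [Fintype V] [DecidableEq V] : Matrix (V × V) (V × V) ℂ :=
  Matrix.of fun p q => if p.1 = q.2 ∧ p.2 = q.1 then 1 else 0

/-- Szegedy's quantum walk `W = SWAP · (2Π_A − I)` of a walk with matrix `Ps`. -/
def Wmat (Ps : Matrix V V ℝ) : Matrix (V × V) (V × V) ℂ :=
  swapMat V * ((2 : ℂ) • projA Ps - 1)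

/-- The initial state `|init_ip⟩ = (1/√(N−1)) Σ_{x ≠ m} |x⟩ ⊗ |P(s)_x⟩`. -/
def initIp (Ps : Matrix V V ℝ) (m : V) : V × V → ℂ :=
  fun p => if p.1 = m then 0
    else ((1 / Real.sqrt ((Fintype.card V : ℝ) - 1) : ℝ) : ℂ) * ((Real.sqrt (Ps p.1 p.2) : ℝ) : ℂ)

/-- The discriminant matrix, `D_{xy} = √(M_{xy} M_{yx})`. -/
def discr (M : Matrix V V ℝ) : Matrix V V ℝ :=
  Matrix.of fun x y => Real.sqrt (M x y * M y x)

/-- The unit vector `√π̄ = (1/√(N−1)) Σ_{x ≠ m} |x⟩`. -/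
def sqrtPiBar (m : V) : V → ℝ :=
  fun x => if x = m then 0 else 1 / Real.sqrt ((Fintype.card V : ℝ) - 1)

/-- `(θ, φ)` is an orthonormal eigenbasis of the (unitary) matrix `M`, with
eigenvalues `e^{iθ_k}` and eigenvectors `φ_k`. -/
def IsONEigenbasis {ι : Type*} [Fintype ι] [DecidableEq ι] (M : Matrix ι ι ℂ)
    (θ : ι → ℝ) (φ : ι → (ι → ℂ)) : Prop :=
  (∀ k l, cip (φ k) (φ l) = if k = l then 1 else 0) ∧
  (∀ k, M.mulVec (φ k) = Complex.exp ((θ k : ℂ) * Complex.I) • φ k)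

/-- The squared cotangent quantum hitting time
`QHT(U, w)² = Σ_{e^{iθ_k} ≠ 1} |⟨φ_k|w⟩|² cot²(θ_k/2)` computed in the
orthonormal eigenbasis `(θ, φ)`. -/
def QHTsq {ι : Type*} [Fintype ι] (θ : ι → ℝ) (φ : ι → (ι → ℂ)) (w : ι → ℂ) : ℝ :=
  ∑ k, if Complex.exp ((θ k : ℂ) * Complex.I) = 1 then 0
       else Complex.normSq (cip (φ k) w) * (Real.cos (θ k / 2) / Real.sin (θ k / 2)) ^ 2

/-- `(lam, v)` is a real orthonormal eigenbasis of the symmetric matrix `M`. -/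
def IsRealONEigenbasis (M : Matrix V V ℝ) (lam : V → ℝ) (v : V → (V → ℝ)) : Prop :=
  (∀ k l, (∑ x, v k x * v l x) = if k = l then 1 else 0) ∧
  (∀ k, M.mulVec (v k) = lam k • v k)

/-- The interpolated hitting time `HT⁺ = Σ_{λ_k ≠ 1} |⟨λ_k|√π̄⟩|² / (1 − λ_k)`,
computed in the orthonormal eigenbasis `(lam, v)` of the discriminant. -/
def HTplus (lam : V → ℝ) (v : V → (V → ℝ)) (m : V) : ℝ :=
  ∑ k, if lam k = 1 then 0 else (∑ x, v k x * sqrtPiBar m x) ^ 2 / (1 - lam k)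

/-- The map `E : ℂ^V ⊗ ℂ^V → ℂ^V ⊗ ℂ^{d+1}` with `E|x, y_i(x)⟩ = |x, e_i⟩`,
`E|x,x⟩ = |x,↻⟩` for `x ≠ m`, `E|m,m⟩ = −|m,↻⟩`, and `E|x,y⟩ = 0` otherwise. -/
def Emat {G : SimpleGraph V} [DecidableRel G.Adj] {d : ℕ}
    (L : Labeling G d) (m : V) : Matrix (V × Fin (d + 1)) (V × V) ℂ :=
  Matrix.of fun p q =>
    if h : G.Adj q.1 q.2 then
      (if p = (q.1, Fin.castSucc (L.idx q.1 q.2 h)) then 1 else 0)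
    else if q.2 = q.1 then
      (if p = (q.1, Fin.last d) then (if q.1 = m then -1 else 1) else 0)
    else 0

/-- `SWAP` applied to a vector of `ℂ^V ⊗ ℂ^V`. -/
def swapVecC (v : V × V → ℂ) : V × V → ℂ := fun p => v (p.2, p.1)

/-- The unit vector `|x, Ps_x^⊥⟩` orthogonal to `|x, Ps_x⟩` in
`span{|x, Ps_x⟩, SWAP |x, Ps_x⟩}` (Gram–Schmidt phase convention). -/
def perpVec (Ps : Matrix V V ℝ) (x : V) : V × V → ℂ :=
  fun p =>
    (swapVecC (psVec Ps x) - cip (psVec Ps x) (swapVecC (psVec Ps x)) • psVec Ps x) p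
      / ((l2norm (swapVecC (psVec Ps x) - cip (psVec Ps x) (swapVecC (psVec Ps x)) • psVec Ps x) : ℝ) : ℂ)

/-- The isometry `Σ_x (|x, Ps1_x⟩⟨x, Ps2_x| + |x, Ps1_x^⊥⟩⟨x, Ps2_x^⊥|)`;
`R₁ = Rmat P̂(s) P(s)` and `R₂ = Rmat P(s) P(s)`. -/
def Rmat (Ps1 Ps2 : Matrix V V ℝ) : Matrix (V × V) (V × V) ℂ :=
  Matrix.of fun p q => ∑ x, (psVec Ps1 x p * (starRingEnd ℂ) (psVec Ps2 x q)
    + perpVec Ps1 x p * (starRingEnd ℂ) (perpVec Ps2 x q))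

end LQWPaper

namespace LQWPaper

open Matrix in
/-- The action of `M` on coordinates in an orthonormal eigenbasis. -/
lemma IsONEigenbasis.cip_mulVec {ι : Type*} [Fintype ι] [DecidableEq ι] {M : Matrix ι ι ℂ}
    {θ : ι → ℝ} {φ : ι → (ι → ℂ)} (h : IsONEigenbasis M θ φ) (k : ι) (v : ι → ℂ) :
    cip (φ k) (M *ᵥ v) = Complex.exp ((θ k : ℂ) * Complex.I) * cip (φ k) v := by
  set Φ : Matrix ι ι ℂ := Matrix.of fun i k => φ k i with hΦ
  have h1 : Φᴴ * Φ = 1 := by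
    ext k l
    simpa [Matrix.mul_apply, cip, hΦ, Matrix.one_apply] using h.1 k l
  have h2 : Φ * Φᴴ = 1 := mul_eq_one_comm.mp h1
  have h3 : M * Φ = Φ * Matrix.diagonal fun k => Complex.exp ((θ k : ℂ) * Complex.I) := by
    ext i k
    have := congrFun (h.2 k) i
    rw [Matrix.mul_diagonal]
    simpa [Matrix.mul_apply, Matrix.mulVec, dotProduct, hΦ, mul_comm] using this
  have h4 : Φᴴ *ᵥ (M *ᵥ v) =
      (Matrix.diagonal fun k => Complex.exp ((θ k : ℂ) * Complex.I)) *ᵥ (Φᴴ *ᵥ v) := by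
    calc Φᴴ *ᵥ (M *ᵥ v) = Φᴴ *ᵥ (M *ᵥ ((Φ * Φᴴ) *ᵥ v)) := by rw [h2, Matrix.one_mulVec]
      _ = (Φᴴ * (M * Φ) * Φᴴ) *ᵥ v := by simp only [Matrix.mulVec_mulVec, Matrix.mul_assoc]
      _ = _ := by rw [h3, ← Matrix.mul_assoc, h1, Matrix.one_mul, Matrix.mulVec_mulVec]
  have := congrFun h4 k
  rw [Matrix.mulVec_diagonal] at this
  simpa [Matrix.mulVec, dotProduct, hΦ, cip] using this

open Matrix in
/-- Parseval's identity. -/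
lemma IsONEigenbasis.sum_normSq_cip {ι : Type*} [Fintype ι] [DecidableEq ι] {M : Matrix ι ι ℂ}
    {θ : ι → ℝ} {φ : ι → (ι → ℂ)} (h : IsONEigenbasis M θ φ) (v : ι → ℂ) :
    ∑ k, Complex.normSq (cip (φ k) v) = ∑ i, Complex.normSq (v i) := by
  set Φ : Matrix ι ι ℂ := Matrix.of fun i k => φ k i with hΦ
  have h1 : Φᴴ * Φ = 1 := by
    ext k l
    simpa [Matrix.mul_apply, cip, hΦ, Matrix.one_apply] using h.1 k l
  have h2 : Φ * Φᴴ = 1 := mul_eq_one_comm.mp h1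
  have h3 : ∀ u : ι → ℂ, ((∑ i, Complex.normSq (u i) : ℝ) : ℂ) = star u ⬝ᵥ u := by
    intro u
    simp [dotProduct, Complex.normSq_eq_conj_mul_self]
  have h4 : (fun k => cip (φ k) v) = Φᴴ *ᵥ v := by
    ext k
    simp [Matrix.mulVec, dotProduct, hΦ, cip]
  apply Complex.ofReal_injective
  rw [h3 v, h3 (fun k => cip (φ k) v), h4, Matrix.star_mulVec, Matrix.conjTranspose_conjTranspose,
    Matrix.dotProduct_mulVec, Matrix.vecMul_vecMul, h2, Matrix.vecMul_one]

lemma normSq_exp_mul_I_sub_one (t : ℝ) :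
    Complex.normSq (Complex.exp ((t : ℂ) * Complex.I) - 1) = 4 * Real.sin (t / 2) ^ 2 := by
  rw [Complex.exp_mul_I, Complex.normSq_apply]
  have h1 := Real.cos_sq_add_sin_sq t
  have h2 := Real.cos_two_mul (t / 2)
  have h3 := Real.cos_sq_add_sin_sq (t / 2)
  rw [mul_div_cancel₀ _ (two_ne_zero)] at h2
  simp [Complex.cos_ofReal_re, Complex.sin_ofReal_re]
  nlinarith

lemma normSq_exp_mul_I_add_one (t : ℝ) :
    Complex.normSq (Complex.exp ((t : ℂ) * Complex.I) + 1) = 4 * Real.cos (t / 2) ^ 2 := by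
  rw [Complex.exp_mul_I, Complex.normSq_apply]
  have h1 := Real.cos_sq_add_sin_sq t
  have h2 := Real.cos_two_mul (t / 2)
  rw [mul_div_cancel₀ _ (two_ne_zero)] at h2
  simp [Complex.cos_ofReal_re, Complex.sin_ofReal_re]
  nlinarith

lemma cip_add {ι : Type*} [Fintype ι] (v a b : ι → ℂ) : cip v (a + b) = cip v a + cip v b := by
  simp [cip, mul_add, Finset.sum_add_distrib]

lemma cip_sub {ι : Type*} [Fintype ι] (v a b : ι → ℂ) : cip v (a - b) = cip v a - cip v b := by
  simp [cip, mul_sub, Finset.sum_sub_distrib]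

open Matrix in
/-- A Cayley-transform characterization of the quantum hitting time. -/
lemma IsONEigenbasis.QHTsq_eq {ι : Type*} [Fintype ι] [DecidableEq ι] {M : Matrix ι ι ℂ}
    {θ : ι → ℝ} {φ : ι → (ι → ℂ)} (h : IsONEigenbasis M θ φ) (w w₀ y : ι → ℂ)
    (hw₀ : M *ᵥ w₀ = w₀) (hy : M *ᵥ y - y = M *ᵥ (w - w₀) + (w - w₀))
    (hker : ∀ ψ : ι → ℂ, M *ᵥ ψ = ψ → cip ψ y = 0) :
    QHTsq θ φ w = ∑ i, Complex.normSq (y i) := by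
  rw [← h.sum_normSq_cip y, QHTsq]
  refine Finset.sum_congr rfl fun k _ => ?_
  set e := Complex.exp ((θ k : ℂ) * Complex.I) with he
  split_ifs with h1
  · have : M *ᵥ φ k = φ k := by rw [h.2 k, ← he, h1, one_smul]
    rw [hker _ this, map_zero]
  · have h2 : cip (φ k) w₀ = 0 := by
      have h3 := h.cip_mulVec k w₀
      rw [hw₀, ← he] at h3
      have h4 : (e - 1) * cip (φ k) w₀ = 0 := by rw [sub_mul, ← h3]; ring
      exact (mul_eq_zero.mp h4).resolve_left (sub_ne_zero.mpr h1)
    have h3 := congrArg (cip (φ k)) hy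
    rw [cip_sub, cip_add, h.cip_mulVec, h.cip_mulVec, cip_sub, h2, ← he] at h3
    have h4 : (e - 1) * cip (φ k) y = (e + 1) * cip (φ k) w := by linear_combination h3
    have h5 := congrArg Complex.normSq h4
    rw [map_mul, map_mul, he, normSq_exp_mul_I_sub_one, normSq_exp_mul_I_add_one] at h5
    have h6 : Real.sin (θ k / 2) ≠ 0 := by
      intro h0
      apply h1
      have := normSq_exp_mul_I_sub_one (θ k)
      rw [h0] at this
      rw [← sub_eq_zero, ← Complex.normSq_eq_zero, this]
      simp
    field_simp
    linarith

lemma cip_mulVec_of_isHermitian {ι : Type*} [Fintype ι] {S : Matrix ι ι ℂ} (hS : S.IsHermitian)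
    (v w : ι → ℂ) : cip v (S.mulVec w) = cip (S.mulVec v) w := by
  change dotProduct (star v) (S.mulVec w) = dotProduct (star (S.mulVec v)) w
  rw [Matrix.star_mulVec, hS.eq, Matrix.dotProduct_mulVec]

lemma cip_smul {ι : Type*} [Fintype ι] (c : ℂ) (v w : ι → ℂ) : cip v (c • w) = c * cip v w := by
  simp [cip, Finset.mul_sum, mul_left_comm]

lemma ofReal_sum_normSq {ι : Type*} [Fintype ι] (v : ι → ℂ) :
    ((∑ i, Complex.normSq (v i) : ℝ) : ℂ) = cip v v := by
  simp [cip, Complex.normSq_eq_conj_mul_self]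

open Matrix in
/-- The quantum hitting time of a product `S * R` of two reflections, started in a vector fixed
by `R`. -/
lemma IsONEigenbasis.QHTsq_reflections {ι : Type*} [Fintype ι] [DecidableEq ι]
    {S R : Matrix ι ι ℂ} {θ : ι → ℝ} {φ : ι → (ι → ℂ)} (h : IsONEigenbasis (S * R) θ φ)
    (hS : S.IsHermitian) (hR : R.IsHermitian)
    (hSS : ∀ v, S *ᵥ (S *ᵥ v) = v) (hRR : ∀ v, R *ᵥ (R *ᵥ v) = v) (f w w₀ u : ι → ℂ)
    (hRf : R *ᵥ f = f) (hRw₀ : R *ᵥ w₀ = w₀) (hSw₀ : S *ᵥ w₀ = w₀) (hu : w - w₀ = u)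
    (hf : (2 : ℂ) • u = (2 : ℂ) • f - R *ᵥ (S *ᵥ f) - S *ᵥ f) :
    (QHTsq θ φ w : ℂ) = cip f u + cip u f - cip u u := by
  have hfu : u = f - (2⁻¹ : ℂ) • (R *ᵥ (S *ᵥ f) + S *ᵥ f) := by
    have : u = (2⁻¹ : ℂ) • (2 : ℂ) • u := by module
    rw [this, hf]
    module
  have hRu : R *ᵥ u = u := by
    rw [hfu, mulVec_sub, mulVec_smul, mulVec_add, hRR, hRf]
    module
  rw [h.QHTsq_eq w w₀ ((2⁻¹ : ℂ) • (R *ᵥ (S *ᵥ f) - S *ᵥ f)), ofReal_sum_normSq]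
  · have e1 : cip (R *ᵥ (S *ᵥ f)) (R *ᵥ (S *ᵥ f)) = cip f f := by
      rw [← cip_mulVec_of_isHermitian hR, hRR, ← cip_mulVec_of_isHermitian hS, hSS]
    have e2 : cip (S *ᵥ f) (S *ᵥ f) = cip f f := by
      rw [← cip_mulVec_of_isHermitian hS, hSS]
    have c2 : (starRingEnd ℂ) 2 = 2 := map_ofNat _ 2
    set a := R *ᵥ (S *ᵥ f)
    set b := S *ᵥ f
    have e3 : cip ((2⁻¹ : ℂ) • (a - b)) ((2⁻¹ : ℂ) • (a - b)) =
        4⁻¹ * (cip a a - cip a b - cip b a + cip b b) := by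
      simp only [cip, ← Finset.sum_add_distrib, ← Finset.sum_sub_distrib, Finset.mul_sum]
      refine Finset.sum_congr rfl fun i _ => ?_
      simp [c2]
      ring
    have e4 : cip f u + cip u f - cip u u =
        cip f f - 4⁻¹ * (cip a a + cip a b + cip b a + cip b b) := by
      rw [hfu]
      simp only [cip, ← Finset.sum_add_distrib, ← Finset.sum_sub_distrib, Finset.mul_sum]
      refine Finset.sum_congr rfl fun i _ => ?_
      simp [c2]
      ring
    rw [e3, e4, e1, e2]
    ring
  · rw [← mulVec_mulVec, hRw₀, hSw₀]
  · rw [hu, ← mulVec_mulVec, ← mulVec_mulVec, hRu]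
    rw [hfu]
    simp only [mulVec_sub, mulVec_smul, mulVec_add, hRR, hSS]
    module
  · intro ψ hψ
    rw [← mulVec_mulVec] at hψ
    have h1 : R *ᵥ ψ = S *ᵥ ψ := by rw [← hSS (R *ᵥ ψ), hψ]
    rw [cip_smul, cip_sub, cip_mulVec_of_isHermitian hR, cip_mulVec_of_isHermitian hS, hψ,
      cip_mulVec_of_isHermitian hS, ← h1, ← cip_mulVec_of_isHermitian hR, hRf, sub_self, mul_zero]

open Matrix in
/-- `IsONEigenbasis.QHTsq_reflections` for reflections and vectors with real entries. -/
lemma IsONEigenbasis.QHTsq_real_reflections {ι : Type*} [Fintype ι] [DecidableEq ι]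
    {S R : Matrix ι ι ℂ} {θ : ι → ℝ} {φ : ι → (ι → ℂ)} (h : IsONEigenbasis (S * R) θ φ)
    (hS : S.IsHermitian) (hR : R.IsHermitian)
    (hSS : ∀ v, S *ᵥ (S *ᵥ v) = v) (hRR : ∀ v, R *ᵥ (R *ᵥ v) = v)
    (σ ρ : (ι → ℝ) → ι → ℝ)
    (hσ : ∀ v : ι → ℝ, S *ᵥ (fun i => (v i : ℂ)) = fun i => (σ v i : ℂ))
    (hρ : ∀ v : ι → ℝ, R *ᵥ (fun i => (v i : ℂ)) = fun i => (ρ v i : ℂ))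
    (f w w₀ u : ι → ℝ)
    (hRf : ∀ i, ρ f i = f i) (hRw₀ : ∀ i, ρ w₀ i = w₀ i) (hSw₀ : ∀ i, σ w₀ i = w₀ i)
    (hu : ∀ i, w i - w₀ i = u i)
    (hf : ∀ i, 2 * u i = 2 * f i - ρ (σ f) i - σ f i) :
    QHTsq θ φ (fun i => (w i : ℂ)) = 2 * ∑ i, f i * u i - ∑ i, u i ^ 2 := by
  apply Complex.ofReal_injective
  rw [h.QHTsq_reflections hS hR hSS hRR (fun i => (f i : ℂ)) (fun i => (w i : ℂ))
    (fun i => (w₀ i : ℂ)) (fun i => (u i : ℂ))]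
  · simp only [cip, Complex.conj_ofReal]
    push_cast
    simp only [mul_comm (u _ : ℂ) (f _ : ℂ), pow_two]
    ring
  · rw [hρ]; ext i; rw [hRf]
  · rw [hρ]; ext i; rw [hRw₀]
  · rw [hσ]; ext i; rw [hSw₀]
  · ext i; simp [← hu i]
  · rw [hσ, hρ]
    ext i
    have := hf i
    simp only [Pi.smul_apply, Pi.sub_apply, smul_eq_mul]
    exact_mod_cast this

open Matrix in
lemma swapMat_mulVec {V : Type*} [Fintype V] [DecidableEq V] (v : V × V → ℂ) :
    swapMat V *ᵥ v = fun p => v (p.2, p.1) := by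
  ext ⟨x, y⟩
  simp only [swapMat, Matrix.mulVec, dotProduct, Matrix.of_apply, ite_mul, one_mul, zero_mul]
  rw [Finset.sum_eq_single (y, x)]
  · simp
  · rintro ⟨a, b⟩ - hne
    rw [if_neg]
    rintro ⟨h1, h2⟩
    exact hne (by simp_all)
  · simp

lemma swapMat_isHermitian (V : Type*) [Fintype V] [DecidableEq V] :
    (swapMat V).IsHermitian := by
  ext ⟨x, y⟩ ⟨a, b⟩
  simp only [swapMat, Matrix.conjTranspose_apply, Matrix.of_apply]
  by_cases h : x = b ∧ y = a
  · rw [if_pos h, if_pos ⟨h.2.symm, h.1.symm⟩, star_one]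
  · rw [if_neg h, if_neg (fun h' => h ⟨h'.2.symm, h'.1.symm⟩), star_zero]

open Matrix in
lemma two_smul_projA_sub_one_mulVec {V : Type*} [Fintype V] [DecidableEq V]
    (Ps : Matrix V V ℝ) (v : V × V → ℂ) :
    ((2 : ℂ) • projA Ps - 1) *ᵥ v = fun p =>
      2 * ((Real.sqrt (Ps p.1 p.2) : ℝ) : ℂ) *
        (∑ y, ((Real.sqrt (Ps p.1 y) : ℝ) : ℂ) * v (p.1, y)) - v p := by
  ext ⟨x, y⟩
  rw [sub_mulVec, smul_mulVec, one_mulVec]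
  simp only [Pi.sub_apply, Pi.smul_apply, smul_eq_mul]
  congr 1
  rw [mul_assoc]
  congr 1
  simp [projA, psVec, Matrix.mulVec, dotProduct, Fintype.sum_prod_type, Finset.mul_sum,
    mul_assoc, apply_ite]

lemma two_smul_projA_sub_one_isHermitian {V : Type*} [Fintype V] [DecidableEq V]
    (Ps : Matrix V V ℝ) : ((2 : ℂ) • projA Ps - 1).IsHermitian := by
  have h : (projA Ps).IsHermitian := by
    ext p q
    simp [projA, mul_comm]
  simp [Matrix.IsHermitian, Matrix.conjTranspose_sub, Matrix.conjTranspose_smul, h.eq]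

/-- The quantum hitting time of Szegedy's walk, in terms of a solution `g` of the Poisson equation
for the discriminant. -/
lemma QHTsq_Wmat {V : Type*} [Fintype V] [DecidableEq V] (Ps : Matrix V V ℝ)
    (hnonneg : ∀ x y, 0 ≤ Ps x y) (hrow : ∀ x, ∑ y, Ps x y = 1)
    {θ : V × V → ℝ} {φ : V × V → (V × V → ℂ)} (hφ : IsONEigenbasis (Wmat Ps) θ φ)
    (g v v₀ : V → ℝ)
    (hbal : ∀ x y, v₀ x * Real.sqrt (Ps x y) = v₀ y * Real.sqrt (Ps y x))
    (hg : ∀ x, g x - ∑ y, Real.sqrt (Ps x y) * (g y * Real.sqrt (Ps y x)) = v x - v₀ x) :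
    QHTsq θ φ (fun p => ((v p.1 * Real.sqrt (Ps p.1 p.2) : ℝ) : ℂ)) =
      2 * ∑ x, g x * (v x - v₀ x) - ∑ x, (v x - v₀ x) ^ 2 := by
  have hsq : ∀ x, ∑ y, Real.sqrt (Ps x y) * Real.sqrt (Ps x y) = 1 := by
    intro x
    rw [← hrow x]
    exact Finset.sum_congr rfl fun y _ => Real.mul_self_sqrt (hnonneg x y)
  have hfix : ∀ (a : V → ℝ) (p : V × V), 2 * Real.sqrt (Ps p.1 p.2) *
      (∑ y, Real.sqrt (Ps p.1 y) * (a p.1 * Real.sqrt (Ps p.1 y))) -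
        a p.1 * Real.sqrt (Ps p.1 p.2) = a p.1 * Real.sqrt (Ps p.1 p.2) := by
    intro a p
    have : ∑ y, Real.sqrt (Ps p.1 y) * (a p.1 * Real.sqrt (Ps p.1 y)) = a p.1 := by
      simp_rw [mul_left_comm _ (a p.1)]
      rw [← Finset.mul_sum, hsq, mul_one]
    rw [this]
    ring
  rw [IsONEigenbasis.QHTsq_real_reflections hφ (swapMat_isHermitian V)
    (two_smul_projA_sub_one_isHermitian Ps) (fun v => by simp [swapMat_mulVec]) ?_
    (fun v p => v (p.2, p.1))
    (fun v p => 2 * Real.sqrt (Ps p.1 p.2) * (∑ y, Real.sqrt (Ps p.1 y) * v (p.1, y)) - v p)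
    (fun v => swapMat_mulVec _) (fun v => by rw [two_smul_projA_sub_one_mulVec]; push_cast; rfl)
    (fun p => g p.1 * Real.sqrt (Ps p.1 p.2)) (fun p => v p.1 * Real.sqrt (Ps p.1 p.2))
    (fun p => v₀ p.1 * Real.sqrt (Ps p.1 p.2)) (fun p => (v p.1 - v₀ p.1) * Real.sqrt (Ps p.1 p.2))
    (hfix g) (hfix v₀) (fun p => hbal _ _) (fun p => by ring)]
  · have hiso : ∀ a b : V → ℝ, ∑ p : V × V, a p.1 * Real.sqrt (Ps p.1 p.2) *
        (b p.1 * Real.sqrt (Ps p.1 p.2)) = ∑ x, a x * b x := by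
      intro a b
      rw [Fintype.sum_prod_type]
      refine Finset.sum_congr rfl fun x _ => ?_
      simp_rw [mul_mul_mul_comm]
      rw [← Finset.mul_sum, hsq, mul_one]
    simp_rw [pow_two]
    rw [hiso g fun x => v x - v₀ x, hiso (fun x => v x - v₀ x) fun x => v x - v₀ x]
  · rintro ⟨x, y⟩
    simp only
    rw [← hg x]
    ring
  · intro v
    rw [two_smul_projA_sub_one_mulVec, two_smul_projA_sub_one_mulVec]
    ext ⟨x, y⟩
    have h1 : ∑ y, ((Real.sqrt (Ps x y) : ℝ) : ℂ) * ((Real.sqrt (Ps x y) : ℝ) : ℂ) = 1 := by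
      exact_mod_cast hsq x
    have h2 : ∀ A : ℂ, ∑ y, ((Real.sqrt (Ps x y) : ℝ) : ℂ) *
        (2 * ((Real.sqrt (Ps x y) : ℝ) : ℂ) * A - v (x, y)) =
        2 * A - ∑ y, ((Real.sqrt (Ps x y) : ℝ) : ℂ) * v (x, y) := by
      intro A
      rw [← mul_one (2 * A), ← h1, Finset.mul_sum, ← Finset.sum_sub_distrib]
      exact Finset.sum_congr rfl fun y _ => by ring
    simp only [h2]
    ring

section Lackadaisical

variable {V : Type*} [Fintype V] [DecidableEq V] {G : SimpleGraph V} {d : ℕ}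

lemma shiftFun_last (L : Labeling G d) (x : V) :
    shiftFun L (x, Fin.last d) = (x, Fin.last d) := by
  simp [shiftFun]

lemma shiftFun_castSucc (L : Labeling G d) {x y : V} {i j : Fin d} (hi : (L.nbr x i : V) = y)
    (hj : (L.nbr y j : V) = x) : shiftFun L (x, i.castSucc) = (y, j.castSucc) := by
  subst hi
  have : L.idx (L.nbr x i) x (L.adj x i).symm = j :=
    (Equiv.symm_apply_eq _).mpr (Subtype.ext hj.symm)
  rw [shiftFun, dif_neg (Fin.castSucc_ne_last i)]
  exact congrArg (fun k => ((L.nbr x i : V), Fin.castSucc k)) this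

lemma Labeling.exists_nbr_eq (L : Labeling G d) {x y : V} (h : G.Adj x y) :
    ∃ i, (L.nbr x i : V) = y :=
  ⟨L.idx x y h, by simp [Labeling.idx]⟩

lemma shiftFun_involutive (L : Labeling G d) : Function.Involutive (shiftFun L) := by
  rintro ⟨x, a⟩
  induction a using Fin.lastCases with
  | last => rw [shiftFun_last, shiftFun_last]
  | cast i =>
    obtain ⟨j, hj⟩ := L.exists_nbr_eq (L.adj x i).symm
    rw [shiftFun_castSucc L rfl hj, shiftFun_castSucc L hj rfl]

open Matrix in
lemma shiftMat_mulVec (L : Labeling G d) (v : V × Fin (d + 1) → ℂ) :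
    shiftMat L *ᵥ v = fun p => v (shiftFun L p) := by
  ext p
  simp only [shiftMat, Matrix.mulVec, dotProduct, Matrix.of_apply, ite_mul, one_mul, zero_mul]
  rw [Finset.sum_eq_single (shiftFun L p)]
  · rw [if_pos (shiftFun_involutive L p).symm]
  · intro q _ hne
    rw [if_neg]
    rintro rfl
    exact hne (shiftFun_involutive L q).symm
  · simp

lemma shiftMat_isHermitian (L : Labeling G d) : (shiftMat L).IsHermitian := by
  ext p q
  simp only [shiftMat, Matrix.conjTranspose_apply, Matrix.of_apply]
  have : q = shiftFun L p ↔ p = shiftFun L q := by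
    constructor
    · rintro rfl; exact (shiftFun_involutive L p).symm
    · rintro rfl; exact (shiftFun_involutive L q).symm
  simp [this]

/-- The real amplitudes of the coin state. -/
def coinAmp (d : ℕ) (ℓ : ℝ) (a : Fin (d + 1)) : ℝ :=
  if a = Fin.last d then Real.sqrt ℓ / Real.sqrt (d + ℓ) else 1 / Real.sqrt (d + ℓ)

lemma coinVec_eq_coinAmp (d : ℕ) (ℓ : ℝ) (a : Fin (d + 1)) :
    coinVec d ℓ a = (coinAmp d ℓ a : ℂ) := by
  unfold coinVec coinAmp
  split_ifs <;> rfl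

@[simp] lemma coinAmp_last (d : ℕ) (ℓ : ℝ) :
    coinAmp d ℓ (Fin.last d) = Real.sqrt ℓ / Real.sqrt (d + ℓ) := by
  simp [coinAmp]

@[simp] lemma coinAmp_castSucc (ℓ : ℝ) (i : Fin d) :
    coinAmp d ℓ i.castSucc = 1 / Real.sqrt (d + ℓ) := by
  simp [coinAmp, Fin.castSucc_ne_last]

lemma sum_coinAmp_mul_self {ℓ : ℝ} (hℓ : 0 < ℓ) :
    ∑ a, coinAmp d ℓ a * coinAmp d ℓ a = 1 := by
  have h1 : 0 < (d : ℝ) + ℓ := by positivity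
  have h2 := Real.mul_self_sqrt hℓ.le
  have h3 := Real.mul_self_sqrt h1.le
  have h4 := (Real.sqrt_pos.mpr h1).ne'
  rw [Fin.sum_univ_castSucc]
  simp only [coinAmp_castSucc, coinAmp_last, Finset.sum_const, Finset.card_univ, Fintype.card_fin,
    nsmul_eq_mul]
  field_simp
  nlinarith

open Matrix in
lemma coinLift_mul_oracleMat_mulVec (d : ℕ) (ℓ : ℝ) (m : V) (v : V × Fin (d + 1) → ℂ) :
    (coinLift d ℓ * oracleMat d m) *ᵥ v = fun p => (if p.1 = m then -1 else 1) *
      (2 * (coinAmp d ℓ p.2 : ℂ) * (∑ a, (coinAmp d ℓ a : ℂ) * v (p.1, a)) - v p) := by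
  have h : ∀ (v : V × Fin (d + 1) → ℂ),
      oracleMat d m *ᵥ v = fun p => (if p.1 = m then -1 else 1) * v p := by
    intro v
    ext p
    simp [oracleMat, Matrix.mulVec, dotProduct]
  rw [← mulVec_mulVec, h]
  ext ⟨x, a⟩
  simp only [coinLift, Matrix.mulVec, dotProduct, Fintype.sum_prod_type, Matrix.of_apply, ite_mul,
    zero_mul, Finset.sum_ite_irrel, Finset.sum_const_zero, Finset.sum_ite_eq, Finset.mem_univ,
    if_true, coinMat, Matrix.sub_apply, Matrix.smul_apply, coinVec_eq_coinAmp, Complex.conj_ofReal,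
    smul_eq_mul, sub_mul, Finset.sum_sub_distrib, Matrix.one_apply, one_mul]
  split_ifs <;> simp [Finset.mul_sum, mul_assoc, neg_add_eq_sub]

lemma coinLift_mul_oracleMat_isHermitian (d : ℕ) (ℓ : ℝ) (m : V) :
    (coinLift d ℓ * oracleMat d m).IsHermitian := by
  have h : ∀ p q : V × Fin (d + 1), (coinLift d ℓ * oracleMat d m :
      Matrix (V × Fin (d + 1)) (V × Fin (d + 1)) ℂ) p q = if p.1 = q.1 then
      (if p.1 = m then -1 else 1) * (2 * (coinAmp d ℓ p.2 * coinAmp d ℓ q.2 : ℂ) -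
        if p.2 = q.2 then 1 else 0) else 0 := by
    intro p q
    have : oracleMat d m = Matrix.diagonal fun p => if p.1 = m then -1 else 1 := by
      ext p q
      simp [oracleMat, Matrix.diagonal_apply]
    rw [this, Matrix.mul_diagonal]
    by_cases hpq : p.1 = q.1
    · simp [coinLift, coinMat, hpq, coinVec_eq_coinAmp, Matrix.one_apply, mul_comm]
    · simp [coinLift, hpq]
  ext p q
  rw [Matrix.conjTranspose_apply, h, h]
  by_cases hpq : p.1 = q.1
  · simp only [hpq, if_true, eq_comm (a := q.2)]
    split_ifs <;> simp [mul_comm]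
  · simp [hpq, Ne.symm hpq]

/-- The quantum hitting time of the lackadaisical walk, in terms of a solution `g` of the Poisson
equation off `m` that is constant on the neighbors of `m`. -/
lemma QHTsq_Ulazy (L : Labeling G d) (m : V) {ℓ : ℝ} (hℓ : 0 < ℓ)
    {θ : V × Fin (d + 1) → ℝ} {φ : V × Fin (d + 1) → (V × Fin (d + 1) → ℂ)}
    (hφ : IsONEigenbasis (Ulazy L m ℓ) θ φ) (g : V → ℝ) (μ η : ℝ) (hgm : g m = 0)
    (hg : ∀ x, x ≠ m → d * g x - ∑ i, g (L.nbr x i) = (μ - η) * (d + ℓ))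
    (hgn : ∀ i, ℓ * g (L.nbr m i) = η * (d + ℓ)) :
    QHTsq θ φ (fun p => ((if p.1 = m then 0 else μ * coinAmp d ℓ p.2 : ℝ) : ℂ)) =
      2 * (μ - η) * ∑ x, g x - ((Fintype.card V - 1) * (μ - η) ^ 2 + η ^ 2 * d / ℓ) := by
  have h1 : 0 < (d : ℝ) + ℓ := by positivity
  have h2 := Real.sq_sqrt hℓ.le
  have h3 := Real.sq_sqrt h1.le
  have h4 := (Real.sqrt_pos.mpr h1)
  have h5 := (Real.sqrt_pos.mpr hℓ)
  have hc : ∑ a, coinAmp d ℓ a * coinAmp d ℓ a = 1 := sum_coinAmp_mul_self hℓ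
  have hcC : ∑ a, (coinAmp d ℓ a : ℂ) * (coinAmp d ℓ a : ℂ) = 1 := by exact_mod_cast hc
  rw [Ulazy, Matrix.mul_assoc] at hφ
  rw [IsONEigenbasis.QHTsq_real_reflections hφ (shiftMat_isHermitian L)
    (coinLift_mul_oracleMat_isHermitian d ℓ m)
    (fun v => by simp [shiftMat_mulVec, shiftFun_involutive L _]) ?_
    (fun v p => v (shiftFun L p))
    (fun v p => (if p.1 = m then -1 else 1) *
      (2 * coinAmp d ℓ p.2 * (∑ a, coinAmp d ℓ a * v (p.1, a)) - v p))
    (fun v => shiftMat_mulVec L _)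
    (fun v => by
      rw [coinLift_mul_oracleMat_mulVec]
      ext p
      split_ifs <;> push_cast <;> rfl)
    (fun p => g p.1 * coinAmp d ℓ p.2)
    (fun p => if p.1 = m then 0 else μ * coinAmp d ℓ p.2)
    (fun p => if p.1 = m then
      (if p.2 = Fin.last d then -(η * d) / (Real.sqrt ℓ * Real.sqrt (d + ℓ))
        else η / Real.sqrt (d + ℓ)) else η * coinAmp d ℓ p.2)
    (fun p => if p.1 = m then
      (if p.2 = Fin.last d then (η * d) / (Real.sqrt ℓ * Real.sqrt (d + ℓ))
        else -η / Real.sqrt (d + ℓ)) else (μ - η) * coinAmp d ℓ p.2)]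
  · rw [Fintype.sum_prod_type, Fintype.sum_prod_type]
    have e1 : ∀ x, ∑ a, g x * coinAmp d ℓ a * (if x = m then
      (if a = Fin.last d then (η * d) / (Real.sqrt ℓ * Real.sqrt (d + ℓ))
        else -η / Real.sqrt (d + ℓ)) else (μ - η) * coinAmp d ℓ a) = (μ - η) * g x := by
      intro x
      by_cases hx : x = m
      · simp [hx, hgm]
      · simp only [hx, if_false]
        rw [← mul_one ((μ - η) * g x), ← hc, Finset.mul_sum]
        exact Finset.sum_congr rfl fun a _ => by ring
    have e2 : ∀ x, ∑ a : Fin (d + 1), (if x = m then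
      (if a = Fin.last d then (η * d) / (Real.sqrt ℓ * Real.sqrt (d + ℓ))
        else -η / Real.sqrt (d + ℓ)) else (μ - η) * coinAmp d ℓ a) ^ 2 =
        (μ - η) ^ 2 + if x = m then η ^ 2 * d / ℓ - (μ - η) ^ 2 else 0 := by
      intro x
      by_cases hx : x = m
      · simp only [hx, if_true, Fin.sum_univ_castSucc, Fin.castSucc_ne_last, if_false,
          Finset.sum_const, Finset.card_univ, Fintype.card_fin, nsmul_eq_mul, div_pow, mul_pow, h2, h3]
        field_simp
        ring
      · simp only [hx, if_false]
        rw [add_zero, ← mul_one ((μ - η) ^ 2), ← hc, Finset.mul_sum]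
        exact Finset.sum_congr rfl fun a _ => by ring
    simp only [e1, e2, Finset.sum_add_distrib, ← Finset.mul_sum, Finset.sum_ite_eq',
      Finset.mem_univ, if_true, Finset.sum_const, Finset.card_univ, nsmul_eq_mul]
    ring
  · rintro ⟨x, a⟩
    by_cases hx : x = m
    · simp [hx, hgm]
    · simp only [hx, if_false]
      simp_rw [mul_left_comm _ (g x)]
      rw [← Finset.mul_sum, hc]
      ring
  · rintro ⟨x, a⟩
    by_cases hx : x = m
    · have : ∑ a : Fin (d + 1), coinAmp d ℓ a * (if a = Fin.last d then
          -(η * d) / (Real.sqrt ℓ * Real.sqrt (d + ℓ)) else η / Real.sqrt (d + ℓ)) = 0 := by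
        simp only [Fin.sum_univ_castSucc, Fin.castSucc_ne_last, if_false, if_true,
          coinAmp_castSucc, coinAmp_last, Finset.sum_const, Finset.card_univ, Fintype.card_fin,
          nsmul_eq_mul]
        field_simp
        ring
      simp only [hx, if_true, this]
      ring
    · simp only [hx, if_false]
      simp_rw [mul_left_comm _ η]
      rw [← Finset.mul_sum, hc]
      ring
  · rintro ⟨x, a⟩
    induction a using Fin.lastCases with
    | last => rw [shiftFun_last]
    | cast i =>
      obtain ⟨j, hj⟩ := L.exists_nbr_eq (L.adj x i).symm
      rw [shiftFun_castSucc L rfl hj]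
      simp only [Fin.castSucc_ne_last, if_false, coinAmp_castSucc, mul_one_div, ite_self]
  · rintro ⟨x, a⟩
    split_ifs <;> ring
  · have hshift : ∀ x i, g (shiftFun L (x, Fin.castSucc i)).1 *
        coinAmp d ℓ (shiftFun L (x, Fin.castSucc i)).2 = g (L.nbr x i) / Real.sqrt (d + ℓ) := by
      intro x i
      obtain ⟨j, hj⟩ := L.exists_nbr_eq (L.adj x i).symm
      rw [shiftFun_castSucc L rfl hj, coinAmp_castSucc, mul_one_div]
    have hsum : ∀ x, ∑ a, coinAmp d ℓ a * (g (shiftFun L (x, a)).1 *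
        coinAmp d ℓ (shiftFun L (x, a)).2) =
        (∑ i, g (L.nbr x i) + ℓ * g x) / (d + ℓ) := by
      intro x
      rw [Fin.sum_univ_castSucc]
      simp only [hshift, shiftFun_last, coinAmp_castSucc, coinAmp_last, ← Finset.mul_sum,
        ← Finset.sum_div]
      have : ∀ t r A : ℝ, 1 / t * (A / t) + r / t * (g x * (r / t)) = (A + r ^ 2 * g x) / t ^ 2 :=
        fun t r A => by ring
      rw [this, h2, h3]
    rintro ⟨x, a⟩
    simp only [hsum]
    by_cases hx : x = m
    · subst hx
      have hn : ∀ i, g (L.nbr x i) = η * (d + ℓ) / ℓ := fun i => by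
        rw [eq_div_iff hℓ.ne', ← hgn i, mul_comm]
      induction a using Fin.lastCases with
      | last =>
        simp only [shiftFun_last, coinAmp_last, if_true, hgm, hn, Finset.sum_const,
          Finset.card_univ, Fintype.card_fin, nsmul_eq_mul]
        field_simp
        rw [h2]
        ring
      | cast i =>
        simp only [hshift, coinAmp_castSucc, Fin.castSucc_ne_last, if_true, if_false, hgm, hn,
          Finset.sum_const, Finset.card_univ, Fintype.card_fin, nsmul_eq_mul]
        field_simp
        ring
    · have : μ - η = (d * g x - ∑ i, g (L.nbr x i)) / (d + ℓ) := by
        rw [hg x hx]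
        field_simp
      simp only [hx, if_false, this, one_mul]
      field_simp
      ring
  · intro v
    rw [coinLift_mul_oracleMat_mulVec, coinLift_mul_oracleMat_mulVec]
    ext ⟨x, a⟩
    have h6 : ∀ A : ℂ, ∑ a, (coinAmp d ℓ a : ℂ) * ((if x = m then -1 else 1) *
        (2 * (coinAmp d ℓ a : ℂ) * A - v (x, a))) = (if x = m then -1 else 1) *
        (2 * A - ∑ a, (coinAmp d ℓ a : ℂ) * v (x, a)) := by
      intro A
      rw [← mul_one (2 * A), ← hcC, Finset.mul_sum, ← Finset.sum_sub_distrib, Finset.mul_sum]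
      exact Finset.sum_congr rfl fun y _ => by ring
    simp only [h6]
    split_ifs <;> ring

end Lackadaisical

section Poisson

variable {V : Type*} [Fintype V] [DecidableEq V] (G : SimpleGraph V) [DecidableRel G.Adj]

lemma lapMatrix_mulVec_eq_sum_ite {d : ℕ} (hreg : G.IsRegularOfDegree d) (h : V → ℝ) (x : V) :
    (G.lapMatrix ℝ).mulVec h x = d * h x - ∑ y, if G.Adj x y then h y else 0 := by
  rw [SimpleGraph.lapMatrix_mulVec_apply, hreg.degree_eq, ← Finset.sum_filter,
    SimpleGraph.neighborFinset_eq_filter]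

lemma sum_lapMatrix_mulVec (h : V → ℝ) : ∑ x, (G.lapMatrix ℝ).mulVec h x = 0 := by
  have h1 : dotProduct (fun _ => (1 : ℝ)) ((G.lapMatrix ℝ).mulVec h) = 0 := by
    rw [Matrix.dotProduct_mulVec, ← Matrix.mulVec_transpose, (G.isSymm_lapMatrix ℝ).eq,
      SimpleGraph.lapMatrix_mulVec_const_eq_zero, zero_dotProduct]
  simpa [dotProduct] using h1

variable {G}

/-- A function harmonic off `m` and vanishing at `m` is zero. -/
lemma eq_zero_of_lapMatrix_mulVec_eq_zero (hconn : G.Connected) {m : V} {h : V → ℝ}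
    (hm : h m = 0) (hh : ∀ x, x ≠ m → (G.lapMatrix ℝ).mulVec h x = 0) : h = 0 := by
  have h1 : (G.lapMatrix ℝ).mulVec h m = 0 := by
    rw [← sum_lapMatrix_mulVec G h]
    exact (Finset.sum_eq_single m (fun x _ hx => hh x hx) (by simp)).symm
  have h2 : (G.lapMatrix ℝ).mulVec h = 0 := by
    ext x
    by_cases hx : x = m
    · rw [hx, h1, Pi.zero_apply]
    · exact hh x hx
  rw [SimpleGraph.lapMatrix_mulVec_eq_zero_iff_forall_reachable] at h2
  ext x
  rw [h2 x m (hconn.preconnected x m), hm, Pi.zero_apply]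

/-- Existence of the solution of the Poisson equation with boundary point `m`. -/
lemma exists_lapMatrix_mulVec_eq (hconn : G.Connected) (m : V) (c : ℝ) :
    ∃ h : V → ℝ, h m = 0 ∧ ∀ x, x ≠ m → (G.lapMatrix ℝ).mulVec h x = c := by
  let A : (V → ℝ) →ₗ[ℝ] (V → ℝ) :=
    { toFun := fun h x => if x = m then h m else (G.lapMatrix ℝ).mulVec h x
      map_add' := fun a b => by
        ext x
        by_cases hx : x = m <;> simp [hx, Matrix.mulVec_add]
      map_smul' := fun r a => by
        ext x
        by_cases hx : x = m <;> simp [hx, Matrix.mulVec_smul] }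
  have hinj : Function.Injective A := by
    rw [← LinearMap.ker_eq_bot, LinearMap.ker_eq_bot']
    intro h hh
    refine eq_zero_of_lapMatrix_mulVec_eq_zero (m := m) hconn ?_ fun x hx => ?_
    · simpa [A] using congrFun hh m
    · simpa [A, hx] using congrFun hh x
  obtain ⟨h, hh⟩ := (LinearMap.injective_iff_surjective.mp hinj) fun x => if x = m then 0 else c
  refine ⟨h, ?_, fun x hx => ?_⟩
  · simpa [A] using congrFun hh m
  · simpa [A, hx] using congrFun hh x

lemma lapMatrix_mulVec_comp_iso {d : ℕ} (hreg : G.IsRegularOfDegree d) (σ : G ≃g G) (h : V → ℝ)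
    (x : V) : (G.lapMatrix ℝ).mulVec (fun y => h (σ y)) x = (G.lapMatrix ℝ).mulVec h (σ x) := by
  rw [lapMatrix_mulVec_eq_sum_ite G hreg, lapMatrix_mulVec_eq_sum_ite G hreg]
  congr 1
  refine Fintype.sum_equiv σ.toEquiv _ _ fun y => ?_
  change _ = if G.Adj (σ x) (σ y) then h (σ y) else 0
  simp only [σ.map_adj_iff]

/-- On a regular locally arc-transitive graph, the expected hitting time of `m` exists and equals
`N - 1` at every neighbor of `m`. -/
lemma exists_hitting_time {d : ℕ} (hd : 1 ≤ d) (hconn : G.Connected)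
    (hreg : G.IsRegularOfDegree d) (hlat : LocallyArcTransitive G) (m : V) :
    ∃ h : V → ℝ, h m = 0 ∧
      (∀ x, x ≠ m → d * h x - (∑ y, if G.Adj x y then h y else 0) = d) ∧
      ∀ y, G.Adj m y → h y = Fintype.card V - 1 := by
  obtain ⟨h, hm, hh⟩ := exists_lapMatrix_mulVec_eq hconn m (d : ℝ)
  refine ⟨h, hm, fun x hx => by rw [← lapMatrix_mulVec_eq_sum_ite G hreg, hh x hx],
    fun y hy => ?_⟩
  have hconst : ∀ z, G.Adj m z → h z = h y := by
    intro z hz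
    obtain ⟨σ, hσm, hσ⟩ := hlat m z y hz hy
    have h0 : (fun x => h (σ x)) - h = 0 := by
      refine eq_zero_of_lapMatrix_mulVec_eq_zero (m := m) hconn ?_ fun x hx => ?_
      · simp [hσm]
      · have : σ x ≠ m := fun h' => hx (σ.injective (h'.trans hσm.symm))
        rw [Matrix.mulVec_sub, Pi.sub_apply, lapMatrix_mulVec_comp_iso hreg, hh _ this, hh _ hx,
          sub_self]
    have := congrFun h0 z
    simp only [Pi.sub_apply, hσ, Pi.zero_apply] at this
    linarith
  have hsum := sum_lapMatrix_mulVec G h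
  have hms : (G.lapMatrix ℝ).mulVec h m = -(d * h y) := by
    rw [lapMatrix_mulVec_eq_sum_ite G hreg, hm]
    have : ∀ z, (if G.Adj m z then h z else 0) = (if G.Adj m z then 1 else 0) * h y := by
      intro z
      by_cases hz : G.Adj m z <;> simp [hz, hconst]
    simp_rw [this]
    rw [← Finset.sum_mul, ← SimpleGraph.degree_eq_sum_if_adj, hreg.degree_eq]
    ring
  rw [← Finset.add_sum_erase _ _ (Finset.mem_univ m), hms,
    Finset.sum_congr rfl fun x hx => hh x (Finset.ne_of_mem_erase hx), Finset.sum_const,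
    Finset.card_erase_of_mem (Finset.mem_univ m), Finset.card_univ, nsmul_eq_mul,
    Nat.cast_sub (Fintype.card_pos_iff.mpr ⟨m⟩)] at hsum
  have hd' : (d : ℝ) ≠ 0 := by positivity
  apply mul_left_cancel₀ hd'
  push_cast at hsum
  linarith

end Poisson

section Interpolated

variable {V : Type*} [Fintype V] [DecidableEq V] (G : SimpleGraph V) [DecidableRel G.Adj]

lemma interp_Pmat_apply (d : ℕ) (m : V) (s : ℝ) (x y : V) :
    interp (Pmat G d) m s x y = if x = m then (if y = m then s else
      if G.Adj m y then (1 - s) / d else 0) else if G.Adj x y then 1 / (d : ℝ) else 0 := by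
  by_cases hx : x = m
  · subst hx
    by_cases hy : y = x
    · subst hy
      simp [interp, absorb, Pmat]
    · by_cases hxy : G.Adj x y <;> simp [interp, absorb, Pmat, hy, hxy, div_eq_mul_inv]
  · by_cases hxy : G.Adj x y
    · simp [interp, absorb, Pmat, hx, hxy]
      ring
    · simp [interp, absorb, Pmat, hx, hxy]

lemma interp_Pmat_nonneg (d : ℕ) (m : V) {s : ℝ} (h0 : 0 ≤ s) (h1 : s ≤ 1) (x y : V) :
    0 ≤ interp (Pmat G d) m s x y := by
  have := sub_nonneg.mpr h1
  rw [interp_Pmat_apply]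
  split_ifs <;> positivity

lemma interp_Pmat_sum {d : ℕ} (hd : 1 ≤ d) (hreg : G.IsRegularOfDegree d) (m : V) (s : ℝ)
    (x : V) : ∑ y, interp (Pmat G d) m s x y = 1 := by
  have hd' : (d : ℝ) ≠ 0 := by positivity
  have h1 : ∑ y, Pmat G d x y = 1 := by
    have : ∀ y, Pmat G d x y = (if G.Adj x y then 1 else 0) * (1 / (d : ℝ)) := by
      intro y
      simp [Pmat]
    simp_rw [this]
    rw [← Finset.sum_mul, ← SimpleGraph.degree_eq_sum_if_adj, hreg.degree_eq]
    field_simp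
  have h2 : ∑ y, absorb (Pmat G d) m x y = 1 := by
    by_cases hx : x = m
    · simp [absorb, hx]
    · simpa [absorb, hx] using h1
  simp only [interp, Matrix.add_apply, Matrix.smul_apply, smul_eq_mul, Finset.sum_add_distrib,
    ← Finset.mul_sum, h1, h2]
  ring

end Interpolated

section HittingTimeFormulas

variable {V : Type*} [Fintype V] [DecidableEq V] {G : SimpleGraph V} [DecidableRel G.Adj] {d : ℕ}

lemma Labeling.sum_nbr (L : Labeling G d) (f : V → ℝ) (x : V) :
    ∑ i, f (L.nbr x i) = ∑ y, if G.Adj x y then f y else 0 := by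
  rw [Equiv.sum_comp (L.nbr x) fun y => f y, ← Finset.sum_filter]
  exact (Finset.sum_subtype _ (by simp) f).symm

lemma QHTsq_Ulazy_initLazy (L : Labeling G d) (m : V) (hd : 1 ≤ d) {N κ μ η : ℝ}
    (hN : N = Fintype.card V) (hN1 : 1 < N) (hμ : μ = 1 / Real.sqrt (N - 1)) (hκ : μ - η = κ)
    (hη : κ * (N - 1) = η * N) {θ : V × Fin (d + 1) → ℝ}
    {φ : V × Fin (d + 1) → (V × Fin (d + 1) → ℂ)}
    (hφ : IsONEigenbasis (Ulazy L m (d / N)) θ φ) {h : V → ℝ} (hm : h m = 0)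
    (hh : ∀ x, x ≠ m → d * h x - (∑ y, if G.Adj x y then h y else 0) = d)
    (hn : ∀ y, G.Adj m y → h y = N - 1) :
    QHTsq θ φ (initLazy m d (d / N)) =
      (N + 1) / N * (2 * κ ^ 2 * ∑ x, h x) - ((N - 1) * κ ^ 2 + η ^ 2 * N) := by
  have hd' : (0 : ℝ) < d := by positivity
  have hN0 : 0 < N := by linarith
  have hinit : initLazy m d (d / N) = fun p : V × Fin (d + 1) =>
      ((if p.1 = m then 0 else μ * coinAmp d (d / N) p.2 : ℝ) : ℂ) := by
    ext p
    rw [initLazy, coinVec_eq_coinAmp, ← hN, ← hμ]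
    split_ifs <;> push_cast <;> rfl
  rw [hinit, QHTsq_Ulazy L m (div_pos hd' hN0) hφ (fun x => κ * (N + 1) / N * h x) μ η
    (by simp [hm]) ?_ ?_, ← hN, hκ, ← Finset.mul_sum]
  · field_simp
  · intro x hx
    have := hh x hx
    rw [← Finset.mul_sum, L.sum_nbr, hκ]
    field_simp
    linear_combination κ * this
  · intro i
    rw [hn _ (L.adj m i)]
    field_simp
    linear_combination hη

lemma QHTsq_Wmat_initIp (hd : 1 ≤ d) (hreg : G.IsRegularOfDegree d) (m : V) {N κ μ η : ℝ}
    (hN : N = Fintype.card V) (hN1 : 1 < N) (hμ : μ = 1 / Real.sqrt (N - 1)) (hκ : μ - η = κ)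
    (hη : κ * (N - 1) = η * N) {θ : V × V → ℝ} {φ : V × V → (V × V → ℂ)}
    (hφ : IsONEigenbasis (Wmat (interp (Pmat G d) m (1 - 1 / N))) θ φ) {h : V → ℝ} (hm : h m = 0)
    (hh : ∀ x, x ≠ m → d * h x - (∑ y, if G.Adj x y then h y else 0) = d)
    (hn : ∀ y, G.Adj m y → h y = N - 1) :
    QHTsq θ φ (initIp (interp (Pmat G d) m (1 - 1 / N)) m) =
      2 * κ ^ 2 * ∑ x, h x - ((N - 1) * κ ^ 2 + η ^ 2 * N) := by
  have hd' : (0 : ℝ) < d := by positivity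
  have hN0 : 0 < N := by linarith
  have hs0 : 0 ≤ 1 - 1 / N := by
    rw [sub_nonneg, div_le_one hN0]
    exact hN1.le
  have hs1 : 1 - 1 / N ≤ 1 := by
    have : 0 < 1 / N := by positivity
    linarith
  have hsN := Real.sq_sqrt hN0.le
  have hsN0 := Real.sqrt_pos.mpr hN0
  have hsd := Real.sq_sqrt hd'.le
  have hsd0 := Real.sqrt_pos.mpr hd'
  set Ps := interp (Pmat G d) m (1 - 1 / N) with hPs
  have hP : ∀ x y, x ≠ m → Real.sqrt (Ps x y) = if G.Adj x y then 1 / Real.sqrt d else 0 := by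
    intro x y hx
    rw [hPs, interp_Pmat_apply, if_neg hx]
    split_ifs <;> simp
  have hPm : ∀ y, y ≠ m → Real.sqrt (Ps m y) =
      if G.Adj m y then 1 / (Real.sqrt N * Real.sqrt d) else 0 := by
    intro y hy
    rw [hPs, interp_Pmat_apply, if_pos rfl, if_neg hy]
    split_ifs
    · rw [sub_sub_cancel, Real.sqrt_div (by positivity), Real.sqrt_div zero_le_one,
        Real.sqrt_one, div_div]
    · exact Real.sqrt_zero
  have hinit : initIp Ps m = fun p : V × V =>
      (((if p.1 = m then 0 else μ) * Real.sqrt (Ps p.1 p.2) : ℝ) : ℂ) := by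
    ext p
    rw [initIp, ← hN, ← hμ]
    split_ifs <;> push_cast <;> simp
  have hdeg : ∀ x, x ≠ m → ∑ y, Real.sqrt (Ps x y) * (κ * h y * Real.sqrt (Ps y x)) =
      κ / d * ∑ y, if G.Adj x y then h y else 0 := by
    intro x hx
    rw [Finset.mul_sum]
    refine Finset.sum_congr rfl fun y _ => ?_
    by_cases hy : y = m
    · simp [hy, hm]
    · rw [hP x y hx, hP y x hy]
      simp only [G.adj_comm y x]
      split_ifs
      · field_simp
        rw [hsd]
        ring
      · simp
  have hdegm : ∑ y, Real.sqrt (Ps m y) * (κ * h y * Real.sqrt (Ps y m)) = η * Real.sqrt N := by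
    have : ∀ y, Real.sqrt (Ps m y) * (κ * h y * Real.sqrt (Ps y m)) =
        (if G.Adj m y then 1 else 0) * (κ * (N - 1) / (Real.sqrt N * d)) := by
      intro y
      by_cases hy : y = m
      · simp [hy, hm]
      · rw [hPm y hy, hP y m hy]
        simp only [G.adj_comm y m]
        split_ifs with hadj
        · rw [hn y hadj]
          field_simp
          rw [hsd]
          ring
        · simp
    simp_rw [this]
    rw [← Finset.sum_mul, ← SimpleGraph.degree_eq_sum_if_adj, hreg.degree_eq, hη]
    field_simp
    rw [hsN]
  rw [hinit, QHTsq_Wmat Ps (interp_Pmat_nonneg G d m hs0 hs1) (interp_Pmat_sum G hd hreg m _) hφ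
    (fun x => κ * h x) (fun x => if x = m then 0 else μ)
    (fun x => if x = m then η * Real.sqrt N else η) ?_ ?_]
  · have e1 : ∀ x, κ * h x * ((if x = m then 0 else μ) - (if x = m then η * Real.sqrt N else η)) =
        κ ^ 2 * h x := by
      intro x
      by_cases hx : x = m
      · simp [hx, hm]
      · simp only [hx, if_false, hκ]
        ring
    have e2 : ∀ x, ((if x = m then 0 else μ) - (if x = m then η * Real.sqrt N else η)) ^ 2 =
        κ ^ 2 + if x = m then η ^ 2 * N - κ ^ 2 else 0 := by
      intro x
      split_ifs
      · linear_combination η ^ 2 * hsN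
      · rw [hκ, add_zero]
    simp_rw [e1, e2]
    rw [← Finset.mul_sum, Finset.sum_add_distrib, Finset.sum_ite_eq' Finset.univ m, Finset.sum_const,
      Finset.card_univ, nsmul_eq_mul, ← hN, if_pos (Finset.mem_univ m)]
    ring
  · intro x y
    by_cases hx : x = m <;> by_cases hy : y = m
    · simp [hx, hy]
    · subst hx
      rw [if_pos rfl, if_neg hy, hPm y hy, hP y x hy]
      simp only [G.adj_comm y x]
      split_ifs
      · field_simp
      · simp
    · subst hy
      rw [if_pos rfl, if_neg hx, hPm x hx, hP x y hx]
      simp only [G.adj_comm x y]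
      split_ifs
      · field_simp
      · simp
    · rw [if_neg hx, if_neg hy, hP x y hx, hP y x hy]
      simp only [G.adj_comm y x]
  · intro x
    by_cases hx : x = m
    · subst hx
      rw [hdegm, if_pos rfl, if_pos rfl, hm]
      ring
    · rw [hdeg x hx, if_neg hx, if_neg hx, hκ]
      field_simp
      linear_combination κ * hh x hx

end HittingTimeFormulas

theorem statement_1 {V : Type*} [Fintype V] [DecidableEq V]
    (G : SimpleGraph V) [DecidableRel G.Adj] (d : ℕ) (L : Labeling G d) (m : V)
    (hd : 1 ≤ d) (hN : 3 ≤ Fintype.card V) (hconn : G.Connected)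
    (hreg : G.IsRegularOfDegree d) (hlat : LocallyArcTransitive G)
    (N ℓ s : ℝ) (hNdef : N = Fintype.card V) (hℓ : ℓ = d / N) (hs : s = 1 - 1 / N)
    (θ : V × Fin (d + 1) → ℝ) (φ : V × Fin (d + 1) → (V × Fin (d + 1) → ℂ))
    (hφ : IsONEigenbasis (Ulazy L m ℓ) θ φ)
    (θ' : V × V → ℝ) (φ' : V × V → (V × V → ℂ))
    (hφ' : IsONEigenbasis (Wmat (interp (Pmat G d) m s)) θ' φ') :
    QHTsq θ φ (initLazy m d ℓ) =
      ((N + 1) / N) * QHTsq θ' φ' (initIp (interp (Pmat G d) m s) m) + 1 / (2 * N - 1) := by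
  subst hℓ hs
  have hN3 : 3 ≤ N := by
    rw [hNdef]
    exact_mod_cast hN
  obtain ⟨h, hm, hh, hn⟩ := exists_hitting_time hd hconn hreg hlat m
  rw [← hNdef] at hn
  have hN0 : N ≠ 0 := by linarith
  obtain ⟨D, hD⟩ : ∃ D, D = 2 * N - 1 := ⟨_, rfl⟩
  have hD0 : D ≠ 0 := by linarith
  rw [← hD]
  obtain ⟨q, hq⟩ : ∃ q, q = Real.sqrt (N - 1) := ⟨_, rfl⟩
  have hq0 : q ≠ 0 := hq ▸ (Real.sqrt_pos.mpr (by linarith)).ne'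
  have hq2 : q ^ 2 = N - 1 := hq ▸ Real.sq_sqrt (by linarith)
  have hμ : 1 / q = 1 / Real.sqrt (N - 1) := by rw [hq]
  have hκ : 1 / q - (N - 1) / (q * D) = N / (q * D) := by
    field_simp
    linear_combination hD
  have hη : N / (q * D) * (N - 1) = (N - 1) / (q * D) * N := by ring
  have hnorm : (N - 1) * (N / (q * D)) ^ 2 + ((N - 1) / (q * D)) ^ 2 * N =
      N / D := by
    field_simp
    rw [hq2, hD]
    ring
  rw [QHTsq_Ulazy_initLazy L m hd hNdef (by linarith) hμ hκ hη hφ hm hh hn,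
    QHTsq_Wmat_initIp hd hreg m hNdef (by linarith) hμ hκ hη hφ' hm hh hn, hnorm]
  field_simp
  ring

end LQWPaper
end
end

section
/- Suppose G is locally arc-transitive and ℓ = d/N. For every integer t ≥ 0, write U_lazy^t |init_lazy⟩ = Σ_{x,a} α_{x,a} |x, a⟩ in the basis {|x, e_i⟩, |x, ↻⟩}. Then the amplitudes on the d outgoing arcs of the marked vertex are all equal: α_{m,e_i} = α_{m,e_j} for all 1 ≤ i, j ≤ d. -/
open scoped BigOperators ComplexConjugate
open Complex

set_option linter.unusedSectionVars false

noncomputable section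

namespace LQWPaper

section Symmetry

variable {V : Type*} [Fintype V] [DecidableEq V] {G : SimpleGraph V} {d : ℕ} (L : Labeling G d)
  (σ : G ≃g G) (m : V) (ℓ : ℝ)

@[simp]
lemma Labeling.nbr_idx (x y : V) (h : G.Adj x y) : (L.nbr x (L.idx x y h) : V) = y := by
  simp [Labeling.idx]

/-- The vertex that an arc or self-loop points to. -/
def arcHead (p : V × Fin (d + 1)) : V :=
  if h : p.2 = Fin.last d then p.1 else L.nbr p.1 (p.2.castPred h)

@[simp]
lemma arcHead_castSucc (x : V) (i : Fin d) : arcHead L (x, i.castSucc) = L.nbr x i := by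
  simp [arcHead, Fin.castSucc_ne_last]

@[simp]
lemma arcHead_last (x : V) : arcHead L (x, Fin.last d) = x := by
  simp [arcHead]

lemma arcHead_eq_fst_iff (p : V × Fin (d + 1)) : arcHead L p = p.1 ↔ p.2 = Fin.last d := by
  obtain ⟨x, a⟩ := p
  induction a using Fin.lastCases with
  | last => simp
  | cast i => simpa [Fin.castSucc_ne_last] using (L.adj x i).ne'

/-- Arcs and self-loops are determined by their endpoints. -/
lemma arc_ext {p q : V × Fin (d + 1)} (h₁ : p.1 = q.1) (h₂ : arcHead L p = arcHead L q) :
    p = q := by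
  have hlast : p.2 = Fin.last d ↔ q.2 = Fin.last d := by
    rw [← arcHead_eq_fst_iff L, ← arcHead_eq_fst_iff L, h₁, h₂]
  obtain ⟨x, a⟩ := p
  obtain ⟨y, b⟩ := q
  obtain rfl : x = y := h₁
  induction a using Fin.lastCases with
  | last => exact congrArg (Prod.mk x) (hlast.mp rfl).symm
  | cast i =>
    induction b using Fin.lastCases with
    | last => exact absurd (hlast.mpr rfl) (Fin.castSucc_ne_last i)
    | cast j =>
      rw [arcHead_castSucc, arcHead_castSucc] at h₂
      rw [(L.nbr x).injective (Subtype.ext h₂)]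

@[simp]
lemma permFun_fst (p : V × Fin (d + 1)) : (permFun L σ p).1 = σ p.1 := by
  unfold permFun
  split_ifs <;> rfl

@[simp]
lemma arcHead_permFun (p : V × Fin (d + 1)) :
    arcHead L (permFun L σ p) = σ (arcHead L p) := by
  by_cases h : p.2 = Fin.last d
  · simp [permFun, h, arcHead]
  · rw [permFun, dif_neg h, arcHead_castSucc, Labeling.nbr_idx]
    simp [arcHead, h]

@[simp]
lemma shiftFun_fst (p : V × Fin (d + 1)) : (shiftFun L p).1 = arcHead L p := by
  by_cases h : p.2 = Fin.last d <;> simp [shiftFun, h, arcHead]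

@[simp]
lemma arcHead_shiftFun (p : V × Fin (d + 1)) : arcHead L (shiftFun L p) = p.1 := by
  by_cases h : p.2 = Fin.last d
  · simp [shiftFun, h, arcHead]
  · rw [shiftFun, dif_neg h, arcHead_castSucc, Labeling.nbr_idx]

lemma permFun_injective : Function.Injective (permFun L σ) := by
  intro p q h
  apply arc_ext L
  · simpa using congrArg Prod.fst h
  · simpa using congrArg (arcHead L) h

lemma permFun_bijective : Function.Bijective (permFun L σ) :=
  Finite.injective_iff_bijective.mp (permFun_injective L σ)

lemma shiftFun_permFun (p : V × Fin (d + 1)) :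
    shiftFun L (permFun L σ p) = permFun L σ (shiftFun L p) :=
  arc_ext L (by simp) (by simp)

lemma permFun_snd_eq_last_iff (p : V × Fin (d + 1)) :
    (permFun L σ p).2 = Fin.last d ↔ p.2 = Fin.last d := by
  simp [← arcHead_eq_fst_iff L]

lemma coinVec_permFun (p : V × Fin (d + 1)) :
    coinVec d ℓ (permFun L σ p).2 = coinVec d ℓ p.2 := by
  simp [coinVec, permFun_snd_eq_last_iff]

lemma mulVec_comp_permFun {M : Matrix (V × Fin (d + 1)) (V × Fin (d + 1)) ℂ}
    (hM : ∀ p q, M (permFun L σ p) (permFun L σ q) = M p q) {v : V × Fin (d + 1) → ℂ}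
    (hv : ∀ p, v (permFun L σ p) = v p) (p : V × Fin (d + 1)) :
    M.mulVec v (permFun L σ p) = M.mulVec v p := by
  simp only [Matrix.mulVec, dotProduct]
  rw [← (permFun_bijective L σ).sum_comp]
  simp only [hM, hv]

lemma shiftMat_permFun (p q : V × Fin (d + 1)) :
    shiftMat L (permFun L σ p) (permFun L σ q) = shiftMat L p q := by
  simp [shiftMat, shiftFun_permFun, (permFun_injective L σ).eq_iff]

lemma coinLift_permFun (p q : V × Fin (d + 1)) :
    coinLift d ℓ (permFun L σ p) (permFun L σ q) = coinLift d ℓ p q := by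
  by_cases h : p.1 = q.1
  · have hsnd : (permFun L σ p).2 = (permFun L σ q).2 ↔ p.2 = q.2 := by
      have := (permFun_injective L σ).eq_iff (a := p) (b := q)
      simpa [Prod.ext_iff, h] using this
    simp [coinLift, coinMat, h, coinVec_permFun, Matrix.one_apply, hsnd]
  · simp [coinLift, h]

variable {σ m}

lemma apply_eq_marked_iff (hσ : σ m = m) (x : V) : σ x = m ↔ x = m := by
  rw [← σ.injective.eq_iff (a := x), hσ]

lemma oracleMat_permFun (hσ : σ m = m) (p q : V × Fin (d + 1)) :
    oracleMat d m (permFun L σ p) (permFun L σ q) = oracleMat d m p q := by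
  simp [oracleMat, (permFun_injective L σ).eq_iff, apply_eq_marked_iff hσ]

lemma initLazy_permFun (hσ : σ m = m) (p : V × Fin (d + 1)) :
    initLazy m d ℓ (permFun L σ p) = initLazy m d ℓ p := by
  simp [initLazy, coinVec_permFun, apply_eq_marked_iff hσ]

lemma Ulazy_pow_mulVec_initLazy_permFun (hσ : σ m = m) (t : ℕ) (p : V × Fin (d + 1)) :
    (Ulazy L m ℓ ^ t).mulVec (initLazy m d ℓ) (permFun L σ p) =
      (Ulazy L m ℓ ^ t).mulVec (initLazy m d ℓ) p := by
  induction t generalizing p with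
  | zero => simp [initLazy_permFun L ℓ hσ]
  | succ t ih =>
    rw [pow_succ', ← Matrix.mulVec_mulVec, Ulazy, ← Matrix.mulVec_mulVec, ← Matrix.mulVec_mulVec]
    exact mulVec_comp_permFun L σ (shiftMat_permFun L σ)
      (mulVec_comp_permFun L σ (coinLift_permFun L σ ℓ)
        (mulVec_comp_permFun L σ (oracleMat_permFun L hσ) ih)) p

end Symmetry

theorem statement_3 {V : Type*} [Fintype V] [DecidableEq V]
    (G : SimpleGraph V) [DecidableRel G.Adj] (d : ℕ) (L : Labeling G d) (m : V)
    (hd : 1 ≤ d) (hN : 3 ≤ Fintype.card V) (hconn : G.Connected)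
    (hreg : G.IsRegularOfDegree d) (hlat : LocallyArcTransitive G)
    (ℓ : ℝ) (hℓ : ℓ = d / (Fintype.card V : ℝ)) (t : ℕ) (i j : Fin d) :
    (Ulazy L m ℓ ^ t).mulVec (initLazy m d ℓ) (m, Fin.castSucc i) =
      (Ulazy L m ℓ ^ t).mulVec (initLazy m d ℓ) (m, Fin.castSucc j) := by
  obtain ⟨σ, hσ, hij⟩ := hlat m _ _ (L.adj m i) (L.adj m j)
  have hperm : permFun L σ (m, i.castSucc) = (m, j.castSucc) :=
    arc_ext L (by simp [hσ]) (by simp [hij])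
  rw [← hperm, Ulazy_pow_mulVec_initLazy_permFun L ℓ hσ]

end LQWPaper
end
end
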